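/- arXiv:1910.03212 — 3 statements merged into one kernel-verified Lean document; each statement's English description precedes it below -/
import Mathlib

section
/- (Routh–Hurwitz criterion for a cubic.) Let b₁, b₂, b₃ ∈ ℝ. All complex roots of the polynomial X³ + b₁X² + b₂X + b₃ have strictly negative real part if and only if b₁ > 0, b₂ > 0, b₃ > 0 and b₁·b₂ > b₃. -/
theorem exists_real_root_cubic (b₁ b₂ b₃ : ℝ) :
    ∃ r : ℝ, r ^ 3 + b₁ * r ^ 2 + b₂ * r + b₃ = 0 := by
  set M : ℝ := 1 + |b₁| + |b₂| + |b₃| with hM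
  have h₁ := abs_nonneg b₁
  have h₂ := abs_nonneg b₂
  have h₃ := abs_nonneg b₃
  have hM1 : 1 ≤ M := by linarith
  have hMsq : M ≤ M ^ 2 := by nlinarith
  have hcube : M ^ 3 = M ^ 2 + |b₁| * M ^ 2 + |b₂| * M ^ 2 + |b₃| * M ^ 2 := by
    rw [pow_succ M 2]
    nth_rewrite 2 [hM]
    ring
  have e₁ : |b₁ * M ^ 2| = |b₁| * M ^ 2 := by rw [abs_mul, abs_of_nonneg (sq_nonneg M)]
  have e₂ : |b₂ * M| ≤ |b₂| * M ^ 2 := by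
    rw [abs_mul, abs_of_nonneg (by linarith : 0 ≤ M)]
    gcongr
  have e₃ : |b₃| ≤ |b₃| * M ^ 2 := le_mul_of_one_le_right h₃ (by linarith)
  have u₁ := abs_le.mp e₁.le
  have u₂ := abs_le.mp e₂
  have u₃ := abs_le.mp e₃
  have hcont : ContinuousOn (fun x : ℝ => x ^ 3 + b₁ * x ^ 2 + b₂ * x + b₃) (Set.Icc (-M) M) := by
    fun_prop
  obtain ⟨r, -, hr⟩ := intermediate_value_Icc (by linarith : -M ≤ M) hcont
    (show (0 : ℝ) ∈ Set.Icc _ _ from ⟨by nlinarith, by nlinarith⟩)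
  exact ⟨r, hr⟩

theorem routh_hurwitz_quadratic (p q : ℝ) :
    (∀ s : ℂ, s ^ 2 + (p : ℂ) * s + (q : ℂ) = 0 → s.re < 0) ↔ 0 < p ∧ 0 < q := by
  constructor
  · intro h
    rcases le_total 0 (p ^ 2 - 4 * q) with hd | hd
    · have hsq := Real.sq_sqrt hd
      have hroot := h (((-p + √(p ^ 2 - 4 * q)) / 2 : ℝ) : ℂ) (by
        norm_cast
        linarith)
      rw [Complex.ofReal_re] at hroot
      have hnn := Real.sqrt_nonneg (p ^ 2 - 4 * q)
      exact ⟨by linarith, by nlinarith⟩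
    · obtain ⟨w, hw⟩ : ∃ w : ℝ, w ^ 2 = 4 * q - p ^ 2 := ⟨_, Real.sq_sqrt (by linarith)⟩
      have hroot := h ⟨-p / 2, w / 2⟩ (by
        apply Complex.ext
        · simp [pow_two]
          linarith
        · simp [pow_two]
          ring)
      have hp : 0 < p := by
        change -p / 2 < 0 at hroot
        linarith
      exact ⟨hp, by nlinarith⟩
  · rintro ⟨hp, hq⟩ s hs
    have hre := congrArg Complex.re hs
    have him := congrArg Complex.im hs
    simp [pow_two] at hre him
    have him' : s.im * (2 * s.re + p) = 0 := by linarith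
    by_contra! hneg
    rcases mul_eq_zero.mp him' with h0 | h0
    · rw [h0] at hre
      nlinarith [mul_nonneg hp.le hneg]
    · linarith


/-- Routh–Hurwitz criterion for a monic real cubic: all complex roots of
`X³ + b₁X² + b₂X + b₃` have strictly negative real part if and only if
`b₁ > 0`, `b₂ > 0`, `b₃ > 0` and `b₁b₂ > b₃`. -/
theorem routh_hurwitz_cubic (b₁ b₂ b₃ : ℝ) :
    (∀ s : ℂ, s ^ 3 + (b₁ : ℂ) * s ^ 2 + (b₂ : ℂ) * s + (b₃ : ℂ) = 0 →
      s.re < 0) ↔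
    (0 < b₁ ∧ 0 < b₂ ∧ 0 < b₃ ∧ b₃ < b₁ * b₂) := by
  obtain ⟨r, hr⟩ := exists_real_root_cubic b₁ b₂ b₃
  obtain ⟨p, rfl⟩ : ∃ p, b₁ = p - r := ⟨b₁ + r, by ring⟩
  obtain ⟨q, rfl⟩ : ∃ q, b₂ = q - p * r := ⟨b₂ + p * r, by ring⟩
  obtain rfl : b₃ = -(q * r) := by linarith
  have hfactor (s : ℂ) : s ^ 3 + ((p - r : ℝ) : ℂ) * s ^ 2 + ((q - p * r : ℝ) : ℂ) * s
      + ((-(q * r) : ℝ) : ℂ) = (s - r) * (s ^ 2 + p * s + q) := by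
    push_cast
    ring
  have hroots : (∀ s : ℂ, (s - r) * (s ^ 2 + p * s + q) = 0 → s.re < 0) ↔
      r < 0 ∧ 0 < p ∧ 0 < q := by
    simp only [mul_eq_zero, or_imp, forall_and, routh_hurwitz_quadratic, sub_eq_zero,
      forall_eq, Complex.ofReal_re]
  simp only [hfactor]
  rw [hroots]
  constructor
  · rintro ⟨hr0, hp, hq⟩
    have hpr := mul_pos hp (neg_pos.mpr hr0)
    have hqr := mul_pos hq (neg_pos.mpr hr0)
    refine ⟨by linarith, by linarith, by linarith, ?_⟩
    have : 0 < p * (q - p * r + r ^ 2) := mul_pos hp (by nlinarith)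
    linarith
  · rintro ⟨h₁, h₂, h₃, h₄⟩
    have hr0 : r < 0 := by
      by_contra! hneg
      have := mul_nonneg h₁.le (sq_nonneg r)
      have := mul_nonneg h₂.le hneg
      have := pow_nonneg hneg 3
      linarith
    have hp : 0 < p * (q - p * r + r ^ 2) := by linarith
    exact ⟨hr0, pos_of_mul_pos_left hp (by positivity), by nlinarith⟩
end

section
/- (High bristle-stiffness limit of the Routh–Hurwitz margin.) Fix f_S, f_C with 0 < f_C < f_S, v_s > 0, m > 0, k_p, k_d, σ1, σ2 ≥ 0, and v ≠ 0. For σ0 > 0 set F = f_C + (f_S − f_C)·exp(−(v/v_s)²), a_z(σ0) = σ0·|v|/F, ρ̃ = ρ_f(v)·v²/v_s² with ρ_f(v) = 2 − 2·f_C/F, and define b₁(σ0) = a_z(σ0) + (k_d + σ2 − σ1·ρ̃)/m, b₂(σ0) = (k_p + (k_d + σ2)·a_z(σ0) − σ0·ρ̃)/m, b₃(σ0) = a_z(σ0)·k_p/m. Then lim_{σ0→∞} (b₁(σ0)·b₂(σ0) − b₃(σ0))/a_z(σ0)² = (k_d + σ2 − 2·|v|·(f_S − f_C)·exp(−(v/v_s)²)/v_s²)/m.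 In particular the limit does not involve the micro-damping σ1, i.e., micro-damping does not affect stability as σ0 → ∞. -/
/-- Leading-order behaviour, as `s → ∞`, of the margin `b₁ b₂ - b₃` whose coefficients are affine
in `s`, relative to `(s p / F)²`. -/
lemma tendsto_affine_margin_div_sq {p F m : ℝ} (hp : p ≠ 0) (hF : F ≠ 0) (A k D r : ℝ) :
    Filter.Tendsto
      (fun s : ℝ =>
        ((s * p / F + A) * ((k + D * (s * p / F) - s * r) / m) - (s * p / F) * k / m) /
          (s * p / F) ^ 2)
      Filter.atTop (nhds ((D - r * F / p) / m)) := by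
  have hcont : Continuous fun x : ℝ =>
      ((p / F + A * x) * ((k * x + D * (p / F) - r) / m) - p / F * k / m * x) / (p / F) ^ 2 := by
    fun_prop
  have h := (hcont.tendsto 0).comp tendsto_inv_atTop_zero
  have hlim : ((p / F + A * 0) * ((k * 0 + D * (p / F) - r) / m) - p / F * k / m * 0) /
      (p / F) ^ 2 = (D - r * F / p) / m := by
    simp only [mul_zero, add_zero, zero_add, sub_zero]
    field_simp
  rw [hlim] at h
  refine h.congr' ?_
  filter_upwards [Filter.eventually_ne_atTop 0] with s hs
  simp only [Function.comp_apply]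
  field_simp

/-- High bristle-stiffness limit of the Routh–Hurwitz margin for the
PD-controlled stage without FI: with `F = f_C + (f_S - f_C) e^{-(v/v_s)²}`,
`a_z(σ0) = σ0 |v|/F`, `ρ̃ = (2 - 2 f_C/F) v²/v_s²`, and
`b₁(σ0) = a_z(σ0) + (k_d + σ2 - σ1 ρ̃)/m`,
`b₂(σ0) = (k_p + (k_d + σ2) a_z(σ0) - σ0 ρ̃)/m`, `b₃(σ0) = a_z(σ0) k_p/m`,
one has
`lim_{σ0→∞} (b₁b₂ - b₃)/a_z² = (k_d + σ2 - 2|v|(f_S - f_C)e^{-(v/v_s)²}/v_s²)/m`;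
in particular the micro-damping `σ1` does not appear in the limit. -/
theorem routh_margin_high_sigma0_limit (fS fC vs m kp kd σ1 σ2 v : ℝ)
    (hfC : 0 < fC) (hfCS : fC < fS) (hvs : 0 < vs) (hm : 0 < m)
    (hkp : 0 ≤ kp) (hkd : 0 ≤ kd) (hσ1 : 0 ≤ σ1) (hσ2 : 0 ≤ σ2) (hv : v ≠ 0) :
    Filter.Tendsto
      (fun σ0 : ℝ =>
        ((σ0 * |v| / (fC + (fS - fC) * Real.exp (-(v / vs) ^ 2)) +
            (kd + σ2 -
              σ1 * ((2 - 2 * fC / (fC + (fS - fC) * Real.exp (-(v / vs) ^ 2))) *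
                v ^ 2 / vs ^ 2)) / m) *
          ((kp + (kd + σ2) * (σ0 * |v| / (fC + (fS - fC) * Real.exp (-(v / vs) ^ 2))) -
              σ0 * ((2 - 2 * fC / (fC + (fS - fC) * Real.exp (-(v / vs) ^ 2))) *
                v ^ 2 / vs ^ 2)) / m) -
          (σ0 * |v| / (fC + (fS - fC) * Real.exp (-(v / vs) ^ 2))) * kp / m) /
          (σ0 * |v| / (fC + (fS - fC) * Real.exp (-(v / vs) ^ 2))) ^ 2)
      Filter.atTop
      (nhds ((kd + σ2 - 2 * |v| * (fS - fC) * Real.exp (-(v / vs) ^ 2) / vs ^ 2) / m)) := by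
  have hF : 0 < fC + (fS - fC) * Real.exp (-(v / vs) ^ 2) :=
    add_pos hfC (mul_pos (sub_pos.2 hfCS) (Real.exp_pos _))
  have hv' : |v| ≠ 0 := abs_ne_zero.2 hv
  convert tendsto_affine_margin_div_sq hv' hF.ne' _ kp (kd + σ2) _ using 3
  generalize Real.exp (-(v / vs) ^ 2) = E at hF ⊢
  rw [← sq_abs v]
  field_simp
  ring
end

section
/- (Uniform stabilizing damping bound for large bristle stiffness.) Under the setting of the high bristle-stiffness limit statement, suppose additionally k_d + σ2 > √2·(f_S − f_C)·exp(−1/2)/v_s. Then for every v ≠ 0 there exists Σ > 0 such that for all σ0 > Σ the Routh–Hurwitz margin is positive: b₁(σ0)·b₂(σ0) − b₃(σ0) > 0 (and also b₁, b₂, b₃ > 0), so the linearized PD-controlled motion stage without friction isolator is stable at the slipping equilibrium. -/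
/-- `F = f_C + (f_S - f_C) e^{-(v/v_s)²}`. -/
noncomputable def stribeckF (fS fC vs v : ℝ) : ℝ :=
  fC + (fS - fC) * Real.exp (-(v / vs) ^ 2)

/-- `a_z` as a function of the bristle stiffness `σ0`: `a_z(σ0) = σ0 |v|/F`. -/
noncomputable def azOf (fS fC vs v σ0 : ℝ) : ℝ :=
  σ0 * |v| / stribeckF fS fC vs v

/-- Coupling term `ρ̃ = (2 - 2 f_C/F) v²/v_s²`. -/
noncomputable def rhoTilde (fS fC vs v : ℝ) : ℝ :=
  (2 - 2 * fC / stribeckF fS fC vs v) * v ^ 2 / vs ^ 2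

/-- `b₁(σ0) = a_z(σ0) + (k_d + σ2 - σ1 ρ̃)/m`. -/
noncomputable def b1Of (fS fC vs m kd σ1 σ2 v σ0 : ℝ) : ℝ :=
  azOf fS fC vs v σ0 + (kd + σ2 - σ1 * rhoTilde fS fC vs v) / m

/-- `b₂(σ0) = (k_p + (k_d + σ2) a_z(σ0) - σ0 ρ̃)/m`. -/
noncomputable def b2Of (fS fC vs m kp kd σ2 v σ0 : ℝ) : ℝ :=
  (kp + (kd + σ2) * azOf fS fC vs v σ0 - σ0 * rhoTilde fS fC vs v) / m

/-- `b₃(σ0) = a_z(σ0) k_p/m`. -/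
noncomputable def b3Of (fS fC vs m kp v σ0 : ℝ) : ℝ :=
  azOf fS fC vs v σ0 * kp / m

theorem two_mul_mul_exp_neg_sq_le (x : ℝ) :
    2 * x * Real.exp (-x ^ 2) ≤ √2 * Real.exp (-(1 / 2 : ℝ)) := by
  have hsq : √2 ^ 2 = 2 := Real.sq_sqrt (by norm_num)
  have hle : √2 * x ≤ Real.exp (x ^ 2 - 1 / 2) := by
    have h := Real.add_one_le_exp (x ^ 2 - 1 / 2)
    nlinarith [sq_nonneg (√2 * x - 1)]
  calc 2 * x * Real.exp (-x ^ 2) = √2 * (√2 * x * Real.exp (-x ^ 2)) := by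
        linear_combination (-(x * Real.exp (-x ^ 2))) * hsq
    _ ≤ √2 * (Real.exp (x ^ 2 - 1 / 2) * Real.exp (-x ^ 2)) := by gcongr
    _ = √2 * Real.exp (-(1 / 2 : ℝ)) := by rw [← Real.exp_add]; ring_nf

theorem stribeckF_pos {fS fC : ℝ} (vs v : ℝ) (hfC : 0 < fC) (hfCS : fC < fS) :
    0 < stribeckF fS fC vs v :=
  add_pos hfC (mul_pos (sub_pos.2 hfCS) (Real.exp_pos _))

theorem rhoTilde_lt {fS fC vs K v : ℝ} (hfC : 0 < fC) (hfCS : fC < fS) (hvs : 0 < vs)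
    (hK : √2 * (fS - fC) * Real.exp (-(1 / 2 : ℝ)) / vs < K) (hv : v ≠ 0) :
    rhoTilde fS fC vs v < K * (|v| / stribeckF fS fC vs v) := by
  have hF := stribeckF_pos vs v hfC hfCS
  have hd : 0 < fS - fC := sub_pos.2 hfCS
  have hsq : (|v| / vs) ^ 2 = (v / vs) ^ 2 := by rw [div_pow, div_pow, sq_abs]
  have hrho : rhoTilde fS fC vs v =
      (fS - fC) * (2 * (|v| / vs) * Real.exp (-(|v| / vs) ^ 2)) / vs *
        (|v| / stribeckF fS fC vs v) := by
    have hE : (fS - fC) * Real.exp (-(|v| / vs) ^ 2) = stribeckF fS fC vs v - fC := by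
      rw [hsq, stribeckF]; ring
    calc rhoTilde fS fC vs v
        = 2 * (stribeckF fS fC vs v - fC) * |v| ^ 2 / vs ^ 2 / stribeckF fS fC vs v := by
          rw [rhoTilde, sq_abs]; field_simp
      _ = _ := by rw [← hE]; field_simp
  rw [hrho]
  refine mul_lt_mul_of_pos_right (lt_of_le_of_lt ?_ hK) (div_pos (abs_pos.2 hv) hF)
  calc _ ≤ (fS - fC) * (√2 * Real.exp (-(1 / 2 : ℝ))) / vs := by
        gcongr ?_ / _
        exact mul_le_mul_of_nonneg_left (two_mul_mul_exp_neg_sq_le _) hd.le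
    _ = _ := by ring

theorem exists_forall_gt_mul_lt_mul {A B c k : ℝ} (hA : 0 < A) (hc : 0 < c) (hk : 0 < k) :
    ∃ S : ℝ, 0 < S ∧ ∀ s : ℝ, S < s →
      0 < s * A + B ∧ s * A * k < (s * A + B) * (k + s * c) := by
  refine ⟨1 + |B| * (c + k) / (A * c), by positivity, fun s hs => ?_⟩
  have hs1 : 1 < s := lt_of_le_of_lt (le_add_of_nonneg_right (by positivity)) hs
  have hlarge : |B| * (c + k) < s * (A * c) :=
    (div_lt_iff₀ (by positivity)).1 (by linarith)
  have hB : -|B| ≤ B := neg_abs_le B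
  have hB0 : 0 ≤ |B| := abs_nonneg B
  constructor
  · have : |B| < s * A := by
      refine lt_of_mul_lt_mul_right (a := c) ?_ hc.le
      nlinarith [mul_nonneg hB0 hk.le]
    linarith
  · have h1 : s * (|B| * (c + k)) < s * (s * (A * c)) :=
      mul_lt_mul_of_pos_left hlarge (by linarith)
    have h2 : 0 ≤ (B + |B|) * (k + s * c) :=
      mul_nonneg (by linarith) (by positivity)
    have h3 : 0 ≤ |B| * k * (s - 1) := mul_nonneg (by positivity) (by linarith)
    linarith

/-- Uniform stabilizing damping bound for large bristle stiffness: if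
`k_d + σ2 > √2 (f_S - f_C) e^{-1/2}/v_s`, then for every `v ≠ 0` there is
`Σ > 0` such that for all `σ0 > Σ` the Routh–Hurwitz conditions
`b₁, b₂, b₃ > 0` and `b₁b₂ > b₃` hold, so the linearized PD-controlled stage
without FI is stable at the slipping equilibrium. -/
theorem stable_for_large_sigma0 (fS fC vs m kp kd σ1 σ2 : ℝ)
    (hfC : 0 < fC) (hfCS : fC < fS) (hvs : 0 < vs) (hm : 0 < m)
    (hkp : 0 < kp) (hkd : 0 ≤ kd) (hσ1 : 0 ≤ σ1) (hσ2 : 0 ≤ σ2)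
    (hdamp : kd + σ2 > Real.sqrt 2 * (fS - fC) * Real.exp (-(1 / 2 : ℝ)) / vs) :
    ∀ v : ℝ, v ≠ 0 → ∃ Sig : ℝ, 0 < Sig ∧ ∀ σ0 : ℝ, Sig < σ0 →
      0 < b1Of fS fC vs m kd σ1 σ2 v σ0 ∧
      0 < b2Of fS fC vs m kp kd σ2 v σ0 ∧
      0 < b3Of fS fC vs m kp v σ0 ∧
      b3Of fS fC vs m kp v σ0 <
        b1Of fS fC vs m kd σ1 σ2 v σ0 * b2Of fS fC vs m kp kd σ2 v σ0 := by
  intro v hv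
  have hA : 0 < |v| / stribeckF fS fC vs v :=
    div_pos (abs_pos.2 hv) (stribeckF_pos vs v hfC hfCS)
  have hc := sub_pos.2 (rhoTilde_lt hfC hfCS hvs hdamp hv)
  obtain ⟨S, hS, h⟩ := exists_forall_gt_mul_lt_mul
    (B := (kd + σ2 - σ1 * rhoTilde fS fC vs v) / m) hA hc hkp
  refine ⟨S, hS, fun σ0 hσ0 => ?_⟩
  obtain ⟨h1, h2⟩ := h σ0 hσ0
  have hs : 0 < σ0 := hS.trans hσ0
  have haz : azOf fS fC vs v σ0 = σ0 * (|v| / stribeckF fS fC vs v) := mul_div_assoc _ _ _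
  have hb2 : b2Of fS fC vs m kp kd σ2 v σ0 =
      (kp + σ0 * ((kd + σ2) * (|v| / stribeckF fS fC vs v) - rhoTilde fS fC vs v)) / m := by
    rw [b2Of, haz]; ring
  rw [hb2, b1Of, b3Of, haz]
  exact ⟨h1, div_pos (add_pos hkp (mul_pos hs hc)) hm, by positivity,
    (div_lt_div_of_pos_right h2 hm).trans_eq (mul_div_assoc _ _ _)⟩
end
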